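/- arXiv:2005.02685 — 2 statements merged into one kernel-verified Lean document; each statement's English description precedes it below -/
import Mathlib

section
/- The series ∑_{k=1}^∞ (ζ(2k) − 1)·F_{2k−1} converges and equals (π/√5)·tan(√5·π/2) + 1/2. -/
open Real

def lucas : ℕ → ℕ
  | 0 => 2
  | 1 => 1
  | n + 2 => lucas n + lucas (n + 1)

def fibZ (n : ℤ) : ℤ :=
  if 0 ≤ n then (Nat.fib n.toNat : ℤ) else (-1) ^ (n.natAbs + 1) * (Nat.fib n.natAbs : ℤ)

def lucasZ (n : ℤ) : ℤ :=
  if 0 ≤ n then (lucas n.toNat : ℤ) else (-1) ^ n.natAbs * (lucas n.natAbs : ℤ)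

theorem hasSum_riemannZeta_even_sub_one (k : ℕ) :
    HasSum (fun n : ℕ => 1 / ((n : ℂ) + 2) ^ (2 * k + 2)) (riemannZeta (2 * (k + 1)) - 1) := by
  have hs : Summable fun n : ℕ => 1 / (n : ℂ) ^ (2 * k + 2) := by
    apply Summable.of_norm
    simp
  have hz := zeta_nat_eq_tsum_of_gt_one (k := 2 * k + 2) (by omega)
  have h := (hasSum_nat_add_iff' 2).2 hs.hasSum
  rw [← hz] at h
  convert h using 2
  · rfl
  · push_cast; rfl
  · congr 1; push_cast; ring
  · simp [Finset.sum_range_succ]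

theorem hasSum_div_sq_sub_sq {x : ℂ} (hx : x ∈ Complex.integerComplement) :
    HasSum (fun n : ℕ => x / (((n : ℂ) + 2) ^ 2 - x ^ 2))
      ((1 / x - π * Complex.cot (π * x)) / 2 - x / (1 - x ^ 2)) := by
  have hs := (summable_cotTerm hx).hasSum
  rw [← cot_series_rep' hx] at hs
  have h := (hasSum_nat_add_iff' 1).2 (hs.mul_left (-1 / 2))
  have term (n : ℕ) : -1 / 2 * cotTerm x n = x / (((n : ℂ) + 1) ^ 2 - x ^ 2) := by
    have h1 : x + ((n : ℂ) + 1) ≠ 0 := by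
      simpa using Complex.integerComplement_add_ne_zero hx ((n : ℤ) + 1)
    have h2 : x - ((n : ℂ) + 1) ≠ 0 := by
      simpa [sub_eq_add_neg] using Complex.integerComplement_add_ne_zero hx (-(n + 1) : ℤ)
    have h3 : ((n : ℂ) + 1) ^ 2 - x ^ 2 ≠ 0 := by
      rw [show ((n : ℂ) + 1) ^ 2 - x ^ 2 = -((x + (n + 1)) * (x - (n + 1))) by ring]
      exact neg_ne_zero.2 (mul_ne_zero h1 h2)
    rw [cotTerm_identity hx, mul_one_div, mul_div_assoc', div_eq_div_iff (mul_ne_zero h1 h2) h3]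
    ring
  simp only [term, Finset.sum_range_one] at h
  convert h using 2
  · rfl
  · push_cast; ring
  · ring
  · simp

theorem hasSum_riemannZeta_even_sub_one_mul_pow {x : ℂ} (hx : x ∈ Complex.integerComplement)
    (hx2 : ‖x‖ < 2) :
    HasSum (fun k : ℕ => (riemannZeta (2 * (k + 1)) - 1) * x ^ (2 * k + 1))
      ((1 / x - π * Complex.cot (π * x)) / 2 - x / (1 - x ^ 2)) := by
  have hs : Summable fun p : ℕ × ℕ => 1 / ((p.2 : ℂ) + 2) ^ (2 * p.1 + 2) * x ^ (2 * p.1 + 1) := by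
    have hgeom : Summable fun k : ℕ => ‖x‖ * ((‖x‖ / 2) ^ 2) ^ k :=
      (summable_geometric_of_lt_one (by positivity)
        (pow_lt_one₀ (by positivity) (by linarith) two_ne_zero)).mul_left _
    have hsq : Summable fun n : ℕ => 1 / ((n : ℝ) + 2) ^ 2 := by
      have := (summable_nat_add_iff 2).2 (Real.summable_one_div_nat_pow.2 one_lt_two)
      simpa using this
    refine (hgeom.mul_of_nonneg hsq (fun k => by positivity)
      (fun n => by positivity)).of_norm_bounded
      fun p => ?_
    have hn : ‖(p.2 : ℂ) + 2‖ = p.2 + 2 := by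
      exact_mod_cast Complex.norm_natCast (p.2 + 2)
    rw [norm_mul, norm_div, norm_pow, norm_pow, hn, norm_one]
    calc 1 / ((p.2 : ℝ) + 2) ^ (2 * p.1 + 2) * ‖x‖ ^ (2 * p.1 + 1)
        = ‖x‖ * ((‖x‖ / (p.2 + 2)) ^ 2) ^ p.1 * (1 / ((p.2 : ℝ) + 2) ^ 2) := by
          rw [← pow_mul, div_pow, pow_add, pow_succ ‖x‖]
          field_simp
      _ ≤ _ := by
          gcongr
          simp
  have hrow := hs.hasSum.prod_fiberwise fun k =>
    (hasSum_riemannZeta_even_sub_one k).mul_right (x ^ (2 * k + 1))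
  have hcol := ((Equiv.prodComm ℕ ℕ).hasSum_iff.2 hs.hasSum).prod_fiberwise
    (g := fun n : ℕ => x / (((n : ℂ) + 2) ^ 2 - x ^ 2)) fun n => by
      have hn : ‖(n : ℂ) + 2‖ = n + 2 := by
        exact_mod_cast Complex.norm_natCast (n + 2)
      have hn0 : (n : ℂ) + 2 ≠ 0 := by
        rw [← norm_ne_zero_iff, hn]; positivity
      have hlt : ‖(x / (n + 2)) ^ 2‖ < 1 := by
        rw [norm_pow, norm_div, hn]
        refine pow_lt_one₀ (by positivity) ?_ two_ne_zero
        rw [div_lt_one (by positivity)]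
        linarith [(Nat.cast_nonneg n : (0 : ℝ) ≤ n)]
      have hne : 1 - (x / ((n : ℂ) + 2)) ^ 2 ≠ 0 := by
        intro h
        rw [← sub_eq_zero.1 h] at hlt
        simp at hlt
      have hne' : ((n : ℂ) + 2) ^ 2 - x ^ 2 ≠ 0 := by
        intro h
        apply hne
        field_simp
        simpa using h
      convert (hasSum_geometric_of_norm_lt_one hlt).mul_left (x / ((n : ℂ) + 2) ^ 2) using 1
      · rfl
      · funext k
        simp only [Function.comp_apply, Equiv.prodComm_apply, Prod.swap_prod_mk]
        rw [← pow_mul, div_pow, pow_add, pow_succ x]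
        field_simp
      · field_simp
  rwa [hcol.unique (hasSum_div_sq_sub_sq hx)] at hrow

theorem Irrational.ofReal_mem_integerComplement {x : ℝ} (hx : Irrational x) :
    (x : ℂ) ∈ Complex.integerComplement := by
  rintro ⟨n, hn⟩
  exact hx.ne_int n (by exact_mod_cast hn.symm)

theorem hasSum_riemannZeta_even_sub_one_mul_fib :
    HasSum (fun k : ℕ => (riemannZeta (2 * (k + 1)) - 1) * (Nat.fib (2 * k + 1) : ℂ))
      ((π / Real.sqrt 5 * Real.tan (Real.sqrt 5 * π / 2) + 1 / 2 : ℝ) : ℂ) := by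
  have hφ := hasSum_riemannZeta_even_sub_one_mul_pow
    goldenRatio_irrational.ofReal_mem_integerComplement (by
      rw [Complex.norm_real, Real.norm_eq_abs, abs_of_pos goldenRatio_pos]
      exact goldenRatio_lt_two)
  have hψ := hasSum_riemannZeta_even_sub_one_mul_pow
    goldenConj_irrational.ofReal_mem_integerComplement (by
      rw [Complex.norm_real, Real.norm_eq_abs, abs_of_neg goldenConj_neg]
      linarith [neg_one_lt_goldenConj])
  have hcotφ : Real.cot (π * goldenRatio) = -Real.tan (√5 * π / 2) := by
    rw [show π * goldenRatio = √5 * π / 2 + π / 2 by rw [goldenRatio]; ring,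
      Real.cot_eq_cos_div_sin, Real.tan_eq_sin_div_cos, Real.cos_add_pi_div_two,
      Real.sin_add_pi_div_two, neg_div]
  have hcotψ : Real.cot (π * goldenConj) = Real.tan (√5 * π / 2) := by
    rw [show π * goldenConj = π / 2 - √5 * π / 2 by rw [goldenConj]; ring,
      Real.cot_eq_cos_div_sin, Real.tan_eq_sin_div_cos, Real.cos_pi_div_two_sub,
      Real.sin_pi_div_two_sub]
  have hval : ((1 / goldenRatio - π * Real.cot (π * goldenRatio)) / 2
      - goldenRatio / (1 - goldenRatio ^ 2)
      - ((1 / goldenConj - π * Real.cot (π * goldenConj)) / 2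
      - goldenConj / (1 - goldenConj ^ 2))) / √5 =
      π / √5 * Real.tan (√5 * π / 2) + 1 / 2 := by
    have h5 : √5 ≠ 0 := by positivity
    have hdiv {y : ℝ} (hy : y ≠ 0) (hsq : y ^ 2 = y + 1) : y / (1 - y ^ 2) = -1 := by
      rw [hsq, sub_add_cancel_right, div_neg, div_self hy]
    rw [hdiv goldenRatio_ne_zero goldenRatio_sq, hdiv goldenConj_ne_zero goldenConj_sq,
      hcotφ, hcotψ, one_div, one_div, inv_goldenRatio, inv_goldenConj]
    have := goldenRatio_sub_goldenConj
    field_simp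
    linarith
  rw [← hval]
  convert (hφ.sub hψ).div_const ((√5 : ℝ) : ℂ) using 1
  · rfl
  · funext k
    have hfib : (Nat.fib (2 * k + 1) : ℂ) =
        ((goldenRatio : ℂ) ^ (2 * k + 1) - (goldenConj : ℂ) ^ (2 * k + 1)) / ((√5 : ℝ) : ℂ) := by
      exact_mod_cast congrArg Complex.ofReal (coe_fib_eq (2 * k + 1))
    rw [hfib]
    ring
  · push_cast
    rfl

theorem stmt3 :
    Summable (fun k : ℕ => (riemannZeta (2 * (k + 1)) - 1) * (Nat.fib (2 * k + 1) : ℂ)) ∧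
    ∑' k : ℕ, (riemannZeta (2 * (k + 1)) - 1) * (Nat.fib (2 * k + 1) : ℂ) =
      ((π / Real.sqrt 5 * Real.tan (Real.sqrt 5 * π / 2) + 1 / 2 : ℝ) : ℂ) := by
  exact ⟨hasSum_riemannZeta_even_sub_one_mul_fib.summable,
    hasSum_riemannZeta_even_sub_one_mul_fib.tsum_eq⟩
end

section
/- The series ∑_{k=1}^∞ (ζ(2k) − 1)·L_{2k−1} converges and equals 3/2. -/
open Real

theorem lucas_eq_goldenRatio_pow_add (n : ℕ) :
    (lucas n : ℝ) = goldenRatio ^ n + goldenConj ^ n := by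
  induction n using Nat.twoStepInduction with
  | zero => norm_num [lucas]
  | one => simp [lucas]
  | more n h₀ h₁ =>
    rw [lucas, Nat.cast_add, h₀, h₁]
    linear_combination -goldenRatio ^ n * goldenRatio_sq - goldenConj ^ n * goldenConj_sq

/-- The odd geometric series `∑ x ^ (2k+1) / m ^ (2k+2)` sums to `x / (m² - x²)`. -/
theorem hasSum_odd_pow_div_pow {x m : ℝ} (hx : |x| < m) :
    HasSum (fun k : ℕ => x ^ (2 * k + 1) / m ^ (2 * k + 2)) (x / (m ^ 2 - x ^ 2)) := by
  have hm : 0 < m := (abs_nonneg x).trans_lt hx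
  have hsq : x ^ 2 < m ^ 2 := sq_lt_sq.2 (by rwa [abs_of_pos hm])
  have hr : x ^ 2 / m ^ 2 < 1 := (div_lt_one (by positivity)).2 hsq
  have hne : m ^ 2 - x ^ 2 ≠ 0 := (sub_pos.2 hsq).ne'
  have hne' : 1 - x ^ 2 / m ^ 2 ≠ 0 := (sub_pos.2 hr).ne'
  have h : HasSum (fun k : ℕ => x / m ^ 2 * (x ^ 2 / m ^ 2) ^ k)
      (x / m ^ 2 * (1 - x ^ 2 / m ^ 2)⁻¹) :=
    (hasSum_geometric_of_lt_one (by positivity) hr).mul_left (x / m ^ 2)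
  convert h using 1
  · funext k
    rw [div_pow, ← pow_mul, ← pow_mul, div_mul_div_comm]
    ring
  · field_simp

theorem hasSum_sub_succ_of_antitone {a : ℕ → ℝ} (ha : Antitone a)
    (h : Filter.Tendsto a Filter.atTop (nhds 0)) :
    HasSum (fun n => a n - a (n + 1)) (a 0) := by
  rw [hasSum_iff_tendsto_nat_of_nonneg (fun n => sub_nonneg.2 (ha n.le_succ))]
  simp_rw [Finset.sum_range_sub']
  simpa using h.const_sub (a 0)

theorem antitone_one_div_nat_add {c : ℝ} (hc : 0 < c) : Antitone fun n : ℕ => 1 / (n + c) := by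
  intro i j hij
  have : (i : ℝ) ≤ j := by exact_mod_cast hij
  exact one_div_le_one_div_of_le (by positivity) (by linarith)

theorem tendsto_one_div_nat_add (c : ℝ) :
    Filter.Tendsto (fun n : ℕ => 1 / ((n : ℝ) + c)) Filter.atTop (nhds 0) := by
  simp_rw [one_div]
  exact (Filter.tendsto_atTop_add_const_right _ c tendsto_natCast_atTop_atTop).inv_tendsto_atTop

theorem hasSum_lucas_div_pow (n : ℕ) :
    HasSum (fun k : ℕ => (lucas (2 * k + 1) : ℝ) / ((n : ℝ) + 2) ^ (2 * k + 2))
      ((1 / (n + (2 - goldenRatio)) - 1 / ((n + 1 : ℕ) + (2 - goldenRatio))) / 2 +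
        (1 / (n + (1 + goldenRatio)) - 1 / ((n + 1 : ℕ) + (1 + goldenRatio))) / 2) := by
  have hφ := goldenRatio_lt_two
  have hφ' := one_lt_goldenRatio
  have hn : (0 : ℝ) ≤ n := n.cast_nonneg
  have hψ : goldenConj = 1 - goldenRatio := by linarith [goldenRatio_add_goldenConj]
  have h₁ : |goldenRatio| < (n : ℝ) + 2 := abs_lt.2 ⟨by linarith, by linarith⟩
  have h₂ : |goldenConj| < (n : ℝ) + 2 := by
    rw [hψ]; exact abs_lt.2 ⟨by linarith, by linarith⟩
  convert (hasSum_odd_pow_div_pow h₁).add (hasSum_odd_pow_div_pow h₂) using 1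
  · funext k
    rw [lucas_eq_goldenRatio_pow_add, add_div]
  · rw [hψ, sq_sub_sq, sq_sub_sq]
    push_cast
    have e₁ : (n : ℝ) + (2 - goldenRatio) ≠ 0 := by linarith
    have e₂ : (n : ℝ) + 1 + (2 - goldenRatio) ≠ 0 := by linarith
    have e₃ : (n : ℝ) + (1 + goldenRatio) ≠ 0 := by linarith
    have e₄ : (n : ℝ) + 1 + (1 + goldenRatio) ≠ 0 := by linarith
    rw [show (n : ℝ) + 2 + goldenRatio = n + 1 + (1 + goldenRatio) by ring,
      show (n : ℝ) + 2 - goldenRatio = n + (2 - goldenRatio) by ring,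
      show (n : ℝ) + 2 + (1 - goldenRatio) = n + 1 + (2 - goldenRatio) by ring,
      show (n : ℝ) + 2 - (1 - goldenRatio) = n + (1 + goldenRatio) by ring]
    generalize goldenRatio = t at *
    field_simp
    ring

theorem hasSum_lucas_telescoping :
    HasSum (fun n : ℕ =>
      (1 / (n + (2 - goldenRatio)) - 1 / ((n + 1 : ℕ) + (2 - goldenRatio))) / 2 +
        (1 / (n + (1 + goldenRatio)) - 1 / ((n + 1 : ℕ) + (1 + goldenRatio))) / 2) (3 / 2) := by
  have h₁ : 0 < 2 - goldenRatio := sub_pos.2 goldenRatio_lt_two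
  have h₂ : 0 < 1 + goldenRatio := by linarith [goldenRatio_pos]
  have value : (3 / 2 : ℝ) = 1 / ((0 : ℕ) + (2 - goldenRatio)) / 2 +
      1 / ((0 : ℕ) + (1 + goldenRatio)) / 2 := by
    have e₁ := h₁.ne'
    have e₂ := h₂.ne'
    have hsq := goldenRatio_sq
    rw [Nat.cast_zero, zero_add, zero_add]
    generalize goldenRatio = t at *
    field_simp
    linear_combination -3 * hsq
  rw [value]
  exact ((hasSum_sub_succ_of_antitone (antitone_one_div_nat_add h₁)
      (tendsto_one_div_nat_add _)).div_const 2).add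
    ((hasSum_sub_succ_of_antitone (antitone_one_div_nat_add h₂)
      (tendsto_one_div_nat_add _)).div_const 2)

theorem hasSum_one_div_add_two_pow {s : ℕ} (hs : 1 < s) :
    HasSum (fun n : ℕ => 1 / ((n : ℂ) + 2) ^ s) (riemannZeta s - 1) := by
  have hsum : Summable fun n : ℕ => 1 / (n : ℂ) ^ s := by
    have := Complex.hasSum_ofReal.2 (Real.summable_one_div_nat_pow.2 hs).hasSum
    simpa using this.summable
  have h := (hasSum_nat_add_iff' 2).2 hsum.hasSum
  rw [← zeta_nat_eq_tsum_of_gt_one hs] at h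
  simpa [Finset.sum_range_succ, (zero_lt_one.trans hs).ne'] using h

theorem hasSum_zeta_sub_one_mul_lucas :
    HasSum (fun k : ℕ => (riemannZeta (2 * (k + 1)) - 1) * (lucas (2 * k + 1) : ℂ))
      (3 / 2 : ℂ) := by
  let f : ℕ × ℕ → ℝ := fun p => (lucas (2 * p.2 + 1) : ℝ) / ((p.1 : ℝ) + 2) ^ (2 * p.2 + 2)
  have hf : Summable f := by
    refine (summable_prod_of_nonneg fun p => by positivity).2
      ⟨fun n => (hasSum_lucas_div_pow n).summable, ?_⟩
    simpa only [f, (hasSum_lucas_div_pow _).tsum_eq] using hasSum_lucas_telescoping.summable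
  have htotal : HasSum f (3 / 2) := by
    rw [← (hf.hasSum.prod_fiberwise hasSum_lucas_div_pow).unique hasSum_lucas_telescoping]
    exact hf.hasSum
  have hswap := (Equiv.prodComm ℕ ℕ).hasSum_iff.2 (Complex.hasSum_ofReal.2 htotal)
  have hfiber : ∀ k : ℕ, HasSum (fun n : ℕ => ((f (n, k) : ℝ) : ℂ))
      ((riemannZeta (2 * (k + 1)) - 1) * (lucas (2 * k + 1) : ℂ)) := by
    intro k
    have h : HasSum (fun n : ℕ => 1 / ((n : ℂ) + 2) ^ (2 * k + 2) * (lucas (2 * k + 1) : ℂ))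
        ((riemannZeta (2 * k + 2 : ℕ) - 1) * (lucas (2 * k + 1) : ℂ)) :=
      (hasSum_one_div_add_two_pow (by omega)).mul_right _
    convert h using 1
    · funext n
      simp [f, div_eq_mul_inv, mul_comm]
    · push_cast
      ring_nf
  simpa using hswap.prod_fiberwise hfiber

theorem stmt4 :
    Summable (fun k : ℕ => (riemannZeta (2 * (k + 1)) - 1) * (lucas (2 * k + 1) : ℂ)) ∧
    ∑' k : ℕ, (riemannZeta (2 * (k + 1)) - 1) * (lucas (2 * k + 1) : ℂ) = (3 / 2 : ℂ) :=
  ⟨hasSum_zeta_sub_one_mul_lucas.summable, hasSum_zeta_sub_one_mul_lucas.tsum_eq⟩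
end
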